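/- For every r ∈ (2/3, 1) there is a constant c_r > 0, depending only on r, such that every string graph with m edges contains an r-edge-balanced separator of size at most c_r·√m. -/

import Mathlib

open scoped BigOperators

/-- A drawing of a simple graph in the plane: vertices are distinct points, each edge is a
simple continuous curve joining its endpoints, not passing through any other vertex point;
two distinct edge curves share only finitely many points, and no three edge curves pass
through a common interior point. -/
structure Drawing {V : Type*} (G : SimpleGraph V) where
  pos : V → ℝ × ℝ
  pos_inj : Function.Injective pos
  curve : G.edgeSet → ℝ → ℝ × ℝ
  curve_cont : ∀ e, ContinuousOn (curve e) (Set.Icc 0 1)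
  curve_inj : ∀ e, Set.InjOn (curve e) (Set.Icc 0 1)
  curve_ends : ∀ e : G.edgeSet, ∃ u v : V, (e : Sym2 V) = s(u, v) ∧
    curve e 0 = pos u ∧ curve e 1 = pos v
  curve_avoid : ∀ (e : G.edgeSet), ∀ t ∈ Set.Ioo (0:ℝ) 1, curve e t ∉ Set.range pos
  curve_finite_inter : ∀ e f : G.edgeSet, e ≠ f →
    (curve e '' Set.Icc 0 1 ∩ curve f '' Set.Icc 0 1).Finite
  no_triple_point : ∀ e f g : G.edgeSet, e ≠ f → f ≠ g → e ≠ g → ∀ p : ℝ × ℝ,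
    ¬ (p ∈ curve e '' Set.Ioo 0 1 ∧ p ∈ curve f '' Set.Ioo 0 1 ∧ p ∈ curve g '' Set.Ioo 0 1)

namespace Drawing

variable {V : Type*} {G : SimpleGraph V} (D : Drawing G)

/-- `p` is a crossing point of the edges `e` and `f`: a common interior point of their curves. -/
def IsCross (e f : G.edgeSet) (p : ℝ × ℝ) : Prop :=
  p ∈ D.curve e '' Set.Ioo 0 1 ∧ p ∈ D.curve f '' Set.Ioo 0 1

/-- The set of crossings of a drawing, recorded as (unordered pair of edges, crossing point). -/
def crossings : Set (Sym2 G.edgeSet × (ℝ × ℝ)) :=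
  { x | ∃ e f : G.edgeSet, e ≠ f ∧ x.1 = s(e, f) ∧ D.IsCross e f x.2 }

/-- The number of crossings of a drawing. -/
noncomputable def numCrossings : ℕ := D.crossings.ncard

/-- The set of unordered pairs of distinct edges that cross each other. -/
def crossingPairs : Set (Sym2 G.edgeSet) :=
  { q | ∃ e f : G.edgeSet, e ≠ f ∧ q = s(e, f) ∧ ∃ p, D.IsCross e f p }

/-- The number of pairs of edges that cross each other. -/
noncomputable def numCrossingPairs : ℕ := D.crossingPairs.ncard

/-- An edge participating in at least one crossing. -/
def CrossingEdge (e : G.edgeSet) : Prop :=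
  ∃ f : G.edgeSet, e ≠ f ∧ ∃ p, D.IsCross e f p

/-- A drawing is straight-line if every edge is the line segment between its endpoints. -/
def IsStraightLine : Prop :=
  ∀ (e : G.edgeSet), ∀ t ∈ Set.Icc (0:ℝ) 1,
    D.curve e t = D.curve e 0 + t • (D.curve e 1 - D.curve e 0)

/-- A convex drawing: the vertices are in convex position and edges are straight segments. -/
def IsConvex : Prop :=
  ConvexIndependent ℝ D.pos ∧ D.IsStraightLine

end Drawing

/-- The crossing number of a graph. -/
noncomputable def crNum {V : Type*} (G : SimpleGraph V) : ℕ :=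
  sInf { n | ∃ D : Drawing G, D.numCrossings = n }

/-- The pair crossing number of a graph. -/
noncomputable def pcrNum {V : Type*} (G : SimpleGraph V) : ℕ :=
  sInf { n | ∃ D : Drawing G, D.numCrossingPairs = n }

/-- The sum of the squares of the degrees of a graph. -/
noncomputable def ssqd {V : Type*} (G : SimpleGraph V) : ℕ :=
  ∑ᶠ v : V, ((G.neighborSet v).ncard) ^ 2

/-- The sum over all vertices of (degree choose 2). -/
noncomputable def bds {V : Type*} (G : SimpleGraph V) : ℕ :=
  ∑ᶠ v : V, ((G.neighborSet v).ncard).choose 2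


/-- A string graph: the intersection graph of a collection of curves in the plane. -/
def IsStringGraph {V : Type*} (G : SimpleGraph V) : Prop :=
  ∃ c : V → ℝ → ℝ × ℝ, (∀ v, ContinuousOn (c v) (Set.Icc 0 1)) ∧
    ∀ u v : V, G.Adj u v ↔ u ≠ v ∧ (c u '' Set.Icc 0 1 ∩ c v '' Set.Icc 0 1).Nonempty

/-- `S` is an `r`-balanced separator: there is a partition `V = V₁ ∪ V₂ ∪ S` with no edge
between `V₁` and `V₂` and `|V₁|, |V₂| ≤ r|V|`. -/
def IsBalancedSeparator {V : Type*} (G : SimpleGraph V) (r : ℝ) (S : Set V) : Prop :=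
  ∃ V1 V2 : Set V, V1 ∪ V2 ∪ S = Set.univ ∧
    Disjoint V1 V2 ∧ Disjoint V1 S ∧ Disjoint V2 S ∧
    (∀ u ∈ V1, ∀ v ∈ V2, ¬ G.Adj u v) ∧
    (V1.ncard : ℝ) ≤ r * (Set.univ : Set V).ncard ∧
    (V2.ncard : ℝ) ≤ r * (Set.univ : Set V).ncard

/-- `S` is an `r`-edge-balanced separator: there is a partition `V = V₁ ∪ V₂ ∪ S` with no
edge between `V₁` and `V₂` such that the induced subgraphs `G[V₁]` and `G[V₂]` each have at
most `r|E|` edges. -/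
def IsEdgeBalancedSeparator {V : Type*} (G : SimpleGraph V) (r : ℝ) (S : Set V) : Prop :=
  ∃ V1 V2 : Set V, V1 ∪ V2 ∪ S = Set.univ ∧
    Disjoint V1 V2 ∧ Disjoint V1 S ∧ Disjoint V2 S ∧
    (∀ u ∈ V1, ∀ v ∈ V2, ¬ G.Adj u v) ∧
    ({e ∈ G.edgeSet | ∀ x ∈ e, x ∈ V1}.ncard : ℝ) ≤ r * (G.edgeSet.ncard : ℝ) ∧
    ({e ∈ G.edgeSet | ∀ x ∈ e, x ∈ V2}.ncard : ℝ) ≤ r * (G.edgeSet.ncard : ℝ)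

namespace StrSep

def gAdj (a b : ℤ × ℤ) : Prop :=
  (a.1 = b.1 ∧ (b.2 = a.2 + 1 ∨ a.2 = b.2 + 1)) ∨ (a.2 = b.2 ∧ (b.1 = a.1 + 1 ∨ a.1 = b.1 + 1))

def Conn (A : Set (ℤ × ℤ)) (a b : ℤ × ℤ) : Prop :=
  a ∈ A ∧ Relation.ReflTransGen (fun x y => gAdj x y ∧ y ∈ A) a b

def cr (a b g : ℤ × ℤ) : ZMod 2 :=
  if a.1 = b.1 ∧ g.1 < a.1 ∧ ((a.2 = g.2 ∧ b.2 = g.2 + 1) ∨ (b.2 = g.2 ∧ a.2 = g.2 + 1)) then 1 else 0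

def lam (g g' p : ℤ × ℤ) : ZMod 2 :=
  if g.1 = g'.1 ∧ p.2 = max g.2 g'.2 ∧ g.1 < p.1 then 1 else 0

lemma two_zero (x : ZMod 2) : x + x = 0 := CharTwo.add_self_eq_zero x

lemma gAdj.symm {a b : ℤ × ℤ} (h : gAdj a b) : gAdj b a := by
  unfold gAdj at *; omega

lemma cr_lam {p q g g' : ℤ × ℤ} (h : gAdj p q) (h' : gAdj g g') (h1 : g ≠ p) (h2 : g ≠ q)
    (h3 : g' ≠ p) (h4 : g' ≠ q) : cr p q g + cr p q g' = lam g g' p + lam g g' q := by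
  obtain ⟨p1, p2⟩ := p
  obtain ⟨q1, q2⟩ := q
  obtain ⟨g1, g2⟩ := g
  obtain ⟨k1, k2⟩ := g'
  simp only [gAdj, cr, lam, ne_eq, Prod.mk.injEq] at *
  rcases h with ⟨rfl, h | h⟩ | ⟨rfl, h | h⟩ <;> rcases h' with ⟨rfl, h' | h'⟩ | ⟨rfl, h' | h'⟩ <;> subst h <;> subst h' <;>
  split_ifs <;> first | rfl | (exfalso; omega)

def Fill (A : Set (ℤ × ℤ)) (b p : ℤ × ℤ) (φ : ℤ × ℤ → ZMod 2) : Prop :=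
  ∀ g g', gAdj g g' → g ∉ A → g' ∉ A → φ g + φ g' = lam g g' b + lam g g' p

lemma exists_fill {A : Set (ℤ × ℤ)} {b p : ℤ × ℤ} (h : Conn A b p) : ∃ φ, Fill A b p φ := by
  obtain ⟨hb, h⟩ := h
  have : p ∈ A ∧ ∃ φ, Fill A b p φ := by
    induction h with
    | refl => exact ⟨hb, fun _ => 0, fun g g' _ _ _ => by simp [two_zero]⟩
    | tail _ hs ih =>
      rename_i y z _
      obtain ⟨hy, φ, hφ⟩ := ih
      refine ⟨hs.2, fun g => φ g + cr y z g, fun g g' hg h1 h2 => ?_⟩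
      have e1 := hφ g g' hg h1 h2
      have e2 := cr_lam hs.1 hg (by rintro rfl; exact h1 hy) (by rintro rfl; exact h1 hs.2)
        (by rintro rfl; exact h2 hy) (by rintro rfl; exact h2 hs.2)
      calc _ = (φ g + φ g') + (cr y z g + cr y z g') := by ring
        _ = lam g g' b + lam g g' z + (lam g g' y + lam g g' y) := by rw [e1, e2]; ring
        _ = _ := by rw [two_zero, add_zero]
  exact this.2

lemma Conn.left {A} {a b : ℤ × ℤ} (h : Conn A a b) : a ∈ A := h.1
lemma Conn.right {A} {a b : ℤ × ℤ} (h : Conn A a b) : b ∈ A := by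
  obtain ⟨h1, h⟩ := h
  induction h with
  | refl => exact h1
  | tail _ h _ => exact h.2
lemma Conn.refl {A} {a : ℤ × ℤ} (h : a ∈ A) : Conn A a a := ⟨h, .refl⟩
lemma Conn.trans {A} {a b c : ℤ × ℤ} (h : Conn A a b) (h' : Conn A b c) : Conn A a c :=
  ⟨h.1, h.2.trans h'.2⟩
lemma Conn.mono {A B} {a b : ℤ × ℤ} (hs : A ⊆ B) (h : Conn A a b) : Conn B a b :=
  ⟨hs h.1, Relation.ReflTransGen.mono (fun _ _ h => ⟨h.1, hs h.2⟩) _ _ h.2⟩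
lemma Conn.step {A} {a b c : ℤ × ℤ} (h : Conn A a b) (h1 : gAdj b c) (h2 : c ∈ A) : Conn A a c :=
  ⟨h.1, h.2.tail ⟨h1, h2⟩⟩
lemma Conn.symm {A} {a b : ℤ × ℤ} (h : Conn A a b) : Conn A b a := by
  obtain ⟨h1, h⟩ := h
  induction h with
  | refl => exact .refl h1
  | @tail y z hy hz ih =>
    exact ((Conn.refl hz.2).step hz.1.symm (Conn.right (⟨h1, hy⟩ : Conn A a y))).trans ih

lemma X_const {A A' B : Set (ℤ × ℤ)} {b p q : ℤ × ℤ} {φ ψ} (hφ : Fill A b p φ) (hψ : Fill A' b q ψ)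
    (hpq : gAdj p q) (hp : p ∈ A) (hq : q ∈ A') (hB : ∀ x ∈ B, x ∉ A ∧ x ∉ A') {x y} (h : Conn B x y) :
    φ x + ψ x + cr p q x = φ y + ψ y + cr p q y := by
  obtain ⟨h1, h⟩ := h
  have : y ∈ B ∧ φ x + ψ x + cr p q x = φ y + ψ y + cr p q y := by
    induction h with
    | refl => exact ⟨h1, rfl⟩
    | tail _ hs ih =>
      rename_i y z _
      refine ⟨hs.2, ih.2.trans ?_⟩
      obtain ⟨y1, y2⟩ := hB y ih.1
      obtain ⟨z1, z2⟩ := hB z hs.2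
      have e1 := hφ y z hs.1 y1 z1
      have e2 := hψ y z hs.1 y2 z2
      have e3 := cr_lam hpq hs.1 (by rintro rfl; exact y1 hp) (by rintro rfl; exact y2 hq)
        (by rintro rfl; exact z1 hp) (by rintro rfl; exact z2 hq)
      rw [← sub_eq_zero, CharTwo.sub_eq_add]
      calc _ = (φ y + φ z) + (ψ y + ψ z) + (cr p q y + cr p q z) := by ring
        _ = (lam y z b + lam y z b) + (lam y z p + lam y z p) + (lam y z q + lam y z q) := by
          rw [e1, e2, e3]; ring
        _ = 0 := by simp [two_zero]
  exact this.2

lemma cr_square {x y : ℤ} {g : ℤ × ℤ} (h : g ≠ (x, y)) :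
    cr (x, y) (x+1, y) g + cr (x+1, y) (x+1, y+1) g + cr (x, y+1) (x+1,y+1) g + cr (x,y) (x,y+1) g = 0 := by
  obtain ⟨g1, g2⟩ := g
  simp only [cr, ne_eq, Prod.mk.injEq, true_and] at *
  split_ifs <;> first | rfl | (exfalso; omega)

lemma tele (f : ℕ → ZMod 2) (N : ℕ) : ∑ i ∈ Finset.range N, (f i + f (i+1)) = f 0 + f N := by
  induction N with
  | zero => simp [two_zero]
  | succ n ih =>
    rw [Finset.sum_range_succ, ih]
    calc _ = f 0 + f (n+1) + (f n + f n) := by ring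
      _ = _ := by rw [two_zero, add_zero]

lemma box_sum (h v : ℕ → ℕ → ZMod 2) (N : ℕ)
    (hsq : ∀ i < N, ∀ j < N, h i j + v (i+1) j + h i (j+1) + v i j = 0) :
    ∑ i ∈ Finset.range N, (h i 0 + h i N) + ∑ j ∈ Finset.range N, (v 0 j + v N j) = 0 := by
  have e1 : ∑ i ∈ Finset.range N, (h i 0 + h i N) =
      ∑ i ∈ Finset.range N, ∑ j ∈ Finset.range N, (h i j + h i (j+1)) :=
    Finset.sum_congr rfl fun i _ => (tele (h i) N).symm
  have e2 : ∑ j ∈ Finset.range N, (v 0 j + v N j) =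
      ∑ i ∈ Finset.range N, ∑ j ∈ Finset.range N, (v i j + v (i+1) j) := by
    rw [Finset.sum_comm]
    exact Finset.sum_congr rfl fun j _ => (tele (fun i => v i j) N).symm
  rw [e1, e2, ← Finset.sum_add_distrib]
  refine Finset.sum_eq_zero fun i hi => ?_
  rw [← Finset.sum_add_distrib]
  refine Finset.sum_eq_zero fun j hj => ?_
  rw [← hsq i (Finset.mem_range.1 hi) j (Finset.mem_range.1 hj)]
  ring

/-- the planarity lemma: a function on edges, zero on squares, cannot equal on the boundary. -/
lemma box_contra (ε : ℤ × ℤ → ℤ × ℤ → ZMod 2) (K : ℕ) (f : ℤ × ℤ → ZMod 2) (g : ℤ × ℤ)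
    (hg : |g.1| < K ∧ |g.2| < K)
    (hsq : ∀ x y : ℤ, ε (x, y) (x+1, y) + ε (x+1, y) (x+1, y+1) + ε (x, y+1) (x+1,y+1) + ε (x,y) (x,y+1) = 0)
    (hb : ∀ p q, gAdj p q → (K ≤ |p.1| ∨ K ≤ |p.2|) → (K ≤ |q.1| ∨ K ≤ |q.2|) → ε p q = f p + f q + cr p q g) :
    False := by
  have B := box_sum (fun i j => ε ((i:ℤ) - K, (j:ℤ) - K) ((i:ℤ) - K + 1, (j:ℤ) - K))
    (fun i j => ε ((i:ℤ) - K, (j:ℤ) - K) ((i:ℤ) - K, (j:ℤ) - K + 1)) (2 * K) (by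
      intro i _ j _
      have := hsq ((i:ℤ) - K) ((j:ℤ) - K)
      rw [← this]
      push_cast
      ring_nf)
  obtain ⟨g1, g2⟩ := g
  simp only [abs_lt] at hg
  have absK : |(-(K:ℤ))| = K := by simp
  have h1 : ∀ i ∈ Finset.range (2*K), ε ((i:ℤ) - K, ((0:ℕ):ℤ) - K) ((i:ℤ) - K + 1, ((0:ℕ):ℤ) - K) =
      f ((i:ℤ) - K, - K) + f (((i+1:ℕ):ℤ) - K, -K) := by
    intro i hi
    rw [hb]
    · simp only [cr]
      rw [if_neg (by simp)]
      push_cast; ring_nf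
    · simp [gAdj]
    · right; simp
    · right; simp
  have h2 : ∀ i ∈ Finset.range (2*K), ε ((i:ℤ) - K, ((2*K:ℕ):ℤ) - K) ((i:ℤ) - K + 1, ((2*K:ℕ):ℤ) - K) =
      f ((i:ℤ) - K, K) + f (((i+1:ℕ):ℤ) - K, K) := by
    intro i hi
    rw [hb]
    · simp only [cr]
      rw [if_neg (by simp)]
      push_cast; ring_nf
    · simp [gAdj]
    · right; push_cast; exact le_abs_self _ |>.trans' (by omega)
    · right; push_cast; exact le_abs_self _ |>.trans' (by omega)
  have h3 : ∀ j ∈ Finset.range (2*K), ε (((0:ℕ):ℤ) - K, (j:ℤ) - K) (((0:ℕ):ℤ) - K, (j:ℤ) - K + 1) =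
      f (-K, (j:ℤ) - K) + f (-K, ((j+1:ℕ):ℤ) - K) := by
    intro i hi
    rw [hb]
    · simp only [cr]
      rw [if_neg (by push_cast; omega)]
      push_cast; ring_nf
    · simp [gAdj]
    · left; simp
    · left; simp
  have h4 : ∀ j ∈ Finset.range (2*K), ε (((2*K:ℕ):ℤ) - K, (j:ℤ) - K) (((2*K:ℕ):ℤ) - K, (j:ℤ) - K + 1) =
      (f (K, (j:ℤ) - K) + f (K, ((j+1:ℕ):ℤ) - K)) + if j = (g2 + K).toNat then 1 else 0 := by
    intro i hi
    rw [hb]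
    · have : cr (((2*K:ℕ):ℤ) - K, (i:ℤ) - K) (((2*K:ℕ):ℤ) - K, (i:ℤ) - K + 1) (g1, g2) =
          if i = (g2 + K).toNat then 1 else 0 := by
        unfold cr
        exact if_congr (by push_cast; omega) rfl rfl
      rw [this]
      push_cast; ring_nf
    · simp [gAdj]
    · left; push_cast; exact le_abs_self _ |>.trans' (by omega)
    · left; push_cast; exact le_abs_self _ |>.trans' (by omega)
  rw [Finset.sum_add_distrib, Finset.sum_add_distrib, Finset.sum_congr rfl h1, Finset.sum_congr rfl h2, Finset.sum_congr rfl h3, Finset.sum_congr rfl h4,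
    tele (fun i => f ((i:ℤ) - K, - K)), tele (fun i => f ((i:ℤ) - K, K)),
    tele (fun i => f (-K, (i:ℤ) - K)), Finset.sum_add_distrib, tele (fun i => f (K, (i:ℤ) - K)),
    Finset.sum_ite_eq' , if_pos (by rw [Finset.mem_range]; omega)] at B
  have e0 : ((0:ℕ):ℤ) - K = -K := by simp
  have e1 : ((2*K:ℕ):ℤ) - K = K := by push_cast; ring
  rw [e0, e1] at B
  have : (1 : ZMod 2) = 0 := by
    rw [← B]
    calc (1 : ZMod 2) = (f (-K, -K) + f (-K, -K)) + (f (K, -K) + f (K, -K)) + (f (-K, K) + f (-K, K)) +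
          (f (K, K) + f (K, K)) + 1 := by simp [two_zero]
      _ = _ := by ring
  exact one_ne_zero this

def del {V : Type*} (G : SimpleGraph V) (S : Set V) : SimpleGraph V where
  Adj u v := G.Adj u v ∧ u ∉ S ∧ v ∉ S
  symm := ⟨fun _ _ h => ⟨h.1.symm, h.2.2, h.2.1⟩⟩
  loopless := ⟨fun _ h => G.loopless.irrefl _ h.1⟩

def eIn {V : Type*} (G : SimpleGraph V) (C : Set V) : Set (Sym2 V) :=
  {e ∈ G.edgeSet | ∀ x ∈ e, x ∈ C}

def comp {V : Type*} (G : SimpleGraph V) (S : Set V) (g : V) : Set V :=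
  {v | (del G S).Reachable g v}

def Giant {V : Type*} (G : SimpleGraph V) (S : Set V) (g : V) : Prop :=
  g ∉ S ∧ 2 * G.edgeSet.ncard < 3 * (eIn G (comp G S g)).ncard

lemma grouping {ι : Type*} [Fintype ι] [DecidableEq ι] (e : ι → ℕ) (m : ℕ) (ht : ∑ i, e i ≤ m)
    (h : ∀ i, 3 * e i ≤ 2 * m) :
    ∃ s : Finset ι, 3 * ∑ i ∈ s, e i ≤ 2 * m ∧ 3 * ∑ i ∈ sᶜ, e i ≤ 2 * m := by
  have tot : ∀ s : Finset ι, ∑ i ∈ s, e i + ∑ i ∈ sᶜ, e i ≤ m := fun s => by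
    rw [Finset.sum_add_sum_compl]; exact ht
  by_cases hb : ∃ i, m ≤ 3 * e i
  · obtain ⟨i, hi⟩ := hb
    refine ⟨{i}, by simpa using h i, ?_⟩
    have := tot {i}
    simp only [Finset.sum_singleton] at this
    omega
  · push Not at hb
    have key : ∀ t : Finset ι, 3 * ∑ i ∈ t, e i < m ∨
        ∃ s : Finset ι, m ≤ 3 * ∑ i ∈ s, e i ∧ 3 * ∑ i ∈ s, e i ≤ 2 * m := by
      intro t
      induction t using Finset.induction_on with
      | empty =>
        by_cases hm : m = 0
        · right; exact ⟨∅, by simp [hm]⟩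
        · left; simp; omega
      | insert a s ha ih =>
        rcases ih with ih | ih
        · have h1 := hb a
          have h2 : ∑ i ∈ insert a s, e i = e a + ∑ i ∈ s, e i := Finset.sum_insert ha
          by_cases h3 : 3 * ∑ i ∈ insert a s, e i < m
          · left; exact h3
          · right; exact ⟨insert a s, by omega, by omega⟩
        · right; exact ih
    rcases key Finset.univ with h1 | ⟨s, h1, h2⟩
    · exact ⟨∅, by simp, by simp only [Finset.compl_empty]; omega⟩
    · exact ⟨s, h2, by have := tot s; omega⟩

lemma exists_giant {V : Type*} [Fintype V] (G : SimpleGraph V) (S : Set V) (r : ℝ) (hr : 2/3 ≤ r)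
    (h : ∀ g, ¬ Giant G S g) : IsEdgeBalancedSeparator G r S := by
  classical
  set m := G.edgeSet.ncard with hm
  let ι := (del G S).ConnectedComponent
  haveI : Fintype ι := Fintype.ofFinite _
  let mk : V → ι := (del G S).connectedComponentMk
  let EC : ι → Finset (Sym2 V) := fun C => G.edgeFinset.filter fun e => ∀ x ∈ e, x ∉ S ∧ mk x = C
  have hm' : G.edgeFinset.card = m := by
    rw [hm, Set.ncard_eq_toFinset_card']; rfl
  have hbound : ∀ C, 3 * (EC C).card ≤ 2 * m := by
    intro C
    rcases (EC C).eq_empty_or_nonempty with h0 | ⟨e, he⟩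
    · simp [h0]
    · induction e with
      | _ x y =>
      simp only [EC, Finset.mem_filter] at he
      have hx := he.2 x (by simp)
      have := h x
      unfold Giant at this
      push Not at this
      refine le_trans ?_ (this hx.1)
      refine Nat.mul_le_mul_left 3 ?_
      rw [← Set.ncard_coe_finset]
      refine Set.ncard_le_ncard ?_ (Set.toFinite _)
      intro e he
      simp only [EC, Finset.coe_filter, Set.mem_setOf_eq, SimpleGraph.mem_edgeFinset] at he
      refine ⟨he.1, fun z hz => ?_⟩
      have h1 := (he.2 z hz).2
      rw [← hx.2] at h1
      exact (SimpleGraph.ConnectedComponent.eq.1 h1).symm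
  have hdisj : ∀ C ∈ (Finset.univ : Finset ι), ∀ C' ∈ (Finset.univ : Finset ι), C ≠ C' → Disjoint (EC C) (EC C') := by
    intro C _ C' _ hne
    rw [Finset.disjoint_left]
    intro e he he'
    induction e with
    | _ x y =>
    simp only [EC, Finset.mem_filter] at he he'
    exact hne ((he.2 x (by simp)).2.symm.trans (he'.2 x (by simp)).2)
  have htot : ∑ C, (EC C).card ≤ m := by
    rw [← Finset.card_biUnion hdisj, ← hm']
    refine Finset.card_le_card ?_
    intro e he
    simp only [Finset.mem_biUnion, EC, Finset.mem_filter] at he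
    obtain ⟨_, _, h1, _⟩ := he
    exact h1
  obtain ⟨s, h1, h2⟩ := grouping (fun C => (EC C).card) m htot hbound
  have part : ∀ s : Finset ι, 3 * ∑ i ∈ s, (EC i).card ≤ 2 * m →
      ({e ∈ G.edgeSet | ∀ x ∈ e, x ∈ {x | x ∉ S ∧ mk x ∈ s}}.ncard : ℝ) ≤ r * (m : ℝ) := by
    intro s hs
    have : {e ∈ G.edgeSet | ∀ x ∈ e, x ∈ {x | x ∉ S ∧ mk x ∈ s}}.ncard ≤ ∑ i ∈ s, (EC i).card := by
      refine le_trans ?_ Finset.card_biUnion_le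
      rw [← Set.ncard_coe_finset]
      refine Set.ncard_le_ncard ?_ (Set.toFinite _)
      rintro e ⟨he, he'⟩
      induction e with
      | _ x y =>
      have hx := he' x (by simp)
      have hy := he' y (by simp)
      have hxy : mk x = mk y := by
        refine SimpleGraph.ConnectedComponent.eq.2 (SimpleGraph.Adj.reachable ?_)
        exact ⟨he, hx.1, hy.1⟩
      simp only [Finset.coe_biUnion, Set.mem_iUnion, Finset.mem_coe]
      refine ⟨mk x, hx.2, ?_⟩
      simp only [EC, Finset.mem_filter, SimpleGraph.mem_edgeFinset]
      refine ⟨he, fun z hz => ?_⟩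
      rcases Sym2.mem_iff.1 hz with rfl | rfl
      · exact ⟨hx.1, rfl⟩
      · exact ⟨hy.1, hxy.symm⟩
    have h3 : 3 * {e ∈ G.edgeSet | ∀ x ∈ e, x ∈ {x | x ∉ S ∧ mk x ∈ s}}.ncard ≤ 2 * m := by omega
    have h4 : (3:ℝ) * ({e ∈ G.edgeSet | ∀ x ∈ e, x ∈ {x | x ∉ S ∧ mk x ∈ s}}.ncard : ℝ) ≤ 2 * (m:ℝ) := by
      exact_mod_cast h3
    have h5 : (0:ℝ) ≤ m := Nat.cast_nonneg _
    nlinarith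
  refine ⟨{x | x ∉ S ∧ mk x ∈ s}, {x | x ∉ S ∧ mk x ∈ sᶜ}, ?_, ?_, ?_, ?_, ?_, part s h1, part sᶜ h2⟩
  · ext x
    simp only [Set.mem_union, Set.mem_setOf_eq, Finset.mem_compl, Set.mem_univ, iff_true]
    tauto
  · rw [Set.disjoint_left]
    rintro x ⟨_, hx⟩ ⟨_, hx'⟩
    exact (Finset.mem_compl.1 hx') hx
  · rw [Set.disjoint_left]; rintro x ⟨hx, _⟩ hx'; exact hx hx'
  · rw [Set.disjoint_left]; rintro x ⟨hx, _⟩ hx'; exact hx hx'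
  · rintro u ⟨hu, hu'⟩ v ⟨hv, hv'⟩ hadj
    have : mk u = mk v := SimpleGraph.ConnectedComponent.eq.2 (SimpleGraph.Adj.reachable ⟨hadj, hu, hv⟩)
    exact (Finset.mem_compl.1 hv') (this ▸ hu')

lemma comp_notMem {V : Type*} {G : SimpleGraph V} {S : Set V} {g v : V} (hg : g ∉ S)
    (hv : v ∈ comp G S g) : v ∉ S := by
  obtain ⟨p⟩ := (show (del G S).Reachable g v from hv).symm
  cases p with
  | nil => exact hg
  | cons h _ => exact h.2.1

lemma giant_nest {V : Type*} [Fintype V] {G : SimpleGraph V} {S S' : Set V} {g g' : V} (hS : S ⊆ S')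
    (hg : Giant G S g) (hg' : Giant G S' g') : comp G S' g' ⊆ comp G S g := by
  have hle : del G S' ≤ del G S := fun u v h => ⟨h.1, fun h' => h.2.1 (hS h'), fun h' => h.2.2 (hS h')⟩
  by_contra hcon
  have hdis : Disjoint (eIn G (comp G S g)) (eIn G (comp G S' g')) := by
    rw [Set.disjoint_left]
    rintro e ⟨_, he⟩ ⟨_, he'⟩
    induction e with
    | _ x y =>
    refine hcon fun z hz => ?_
    have h1 : (del G S).Reachable g x := he x (by simp)
    have h2 : (del G S').Reachable g' x := he' x (by simp)
    have h3 : (del G S').Reachable g' z := hz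
    exact h1.trans ((h2.symm.trans h3).mono hle)
  have h1 := Set.ncard_union_eq hdis (Set.toFinite _) (Set.toFinite _)
  have h2 : (eIn G (comp G S g) ∪ eIn G (comp G S' g')).ncard ≤ G.edgeSet.ncard :=
    Set.ncard_le_ncard (by rintro e (he | he) <;> exact he.1) (Set.toFinite _)
  have := hg.2
  have := hg'.2
  omega

lemma giant_nbr {V : Type*} [Fintype V] {G : SimpleGraph V} {S : Set V} {g v : V}
    (hg : Giant G S g) (hv : v ∈ comp G S g) : ∃ u, G.Adj v u := by
  have : (eIn G (comp G S g)).Nonempty := by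
    rw [Set.nonempty_iff_ne_empty]
    intro h
    have := hg.2
    rw [h] at this
    simp at this
  obtain ⟨e, he, he'⟩ := this
  induction e with
  | _ x y =>
  have h1 : (del G S).Reachable g x := he' x (by simp)
  obtain ⟨p⟩ := (show (del G S).Reachable g v from hv).symm.trans h1
  cases p with
  | nil => exact ⟨y, he⟩
  | cons h _ => exact ⟨_, h.1⟩

lemma exists_dist {V : Type*} (G : SimpleGraph V) (ρ : V) (w : V → ℕ) : ∃ d : V → ℕ,
    (∀ u v, G.Adj u v → G.Reachable v ρ → d u ≤ d v + w u) ∧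
    (∀ v, G.Reachable v ρ → (v = ρ ∧ d v = w v) ∨
      ∃ u, G.Adj v u ∧ G.Reachable u ρ ∧ d v = d u + w v) := by
  let d : V → ℕ := fun v => sInf {N | ∃ p : G.Walk v ρ, (p.support.map w).sum = N}
  have hmem : ∀ v, G.Reachable v ρ → ∃ p : G.Walk v ρ, (p.support.map w).sum = d v := by
    intro v ⟨p⟩
    exact Nat.sInf_mem (s := {N | ∃ p : G.Walk v ρ, (p.support.map w).sum = N}) ⟨_, p, rfl⟩
  have hle : ∀ v (p : G.Walk v ρ), d v ≤ (p.support.map w).sum := fun v p => Nat.sInf_le ⟨p, rfl⟩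
  have D1 : ∀ u v, G.Adj u v → G.Reachable v ρ → d u ≤ d v + w u := by
    intro u v h hv
    obtain ⟨p, hp⟩ := hmem v hv
    have := hle u (SimpleGraph.Walk.cons h p)
    simp only [SimpleGraph.Walk.support_cons, List.map_cons, List.sum_cons] at this
    omega
  refine ⟨d, D1, fun v hv => ?_⟩
  obtain ⟨p, hp⟩ := hmem v hv
  cases p with
  | nil => left; simpa using hp.symm
  | @cons _ u _ h q =>
    right
    have h1 := hle u q
    have h2 := D1 v u h ⟨q⟩
    simp only [SimpleGraph.Walk.support_cons, List.map_cons, List.sum_cons] at hp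
    exact ⟨u, h, ⟨q⟩, by omega⟩

lemma count_shift (L : ℕ) (hL : 0 < L) (a c : ℕ) :
    ((Finset.range L).filter fun b => (a + b) / L ≠ (a + c + b) / L).card ≤ c := by
  induction c with
  | zero => simp
  | succ c ih =>
    have : ((Finset.range L).filter fun b => (a + b) / L ≠ (a + (c + 1) + b) / L) ⊆
        ((Finset.range L).filter fun b => (a + b) / L ≠ (a + c + b) / L) ∪
        ((Finset.range L).filter fun b => L ∣ a + c + b + 1) := by
      intro b hb
      simp only [Finset.mem_union, Finset.mem_filter] at hb ⊢
      by_cases h : L ∣ a + c + b + 1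
      · right; exact ⟨hb.1, h⟩
      · left
        refine ⟨hb.1, ?_⟩
        have h1 : a + (c + 1) + b = a + c + b + 1 := by ring
        rw [h1, Nat.succ_div, if_neg h] at hb
        exact hb.2
    refine (Finset.card_le_card this).trans ((Finset.card_union_le _ _).trans (add_le_add ih ?_))
    rw [Finset.card_le_one]
    intro x hx y hy
    simp only [Finset.mem_filter, Finset.mem_range] at hx hy
    have h1 : (a + c + x + 1) ≡ (a + c + y + 1) [MOD L] :=
      ((Nat.modEq_zero_iff_dvd.2 hx.2).trans (Nat.modEq_zero_iff_dvd.2 hy.2).symm)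
    have h2 : x ≡ y [MOD L] := by
      have h3 : (a + c + 1) + x ≡ (a + c + 1) + y [MOD L] := by
        convert h1 using 1 <;> ring
      exact Nat.ModEq.add_left_cancel' _ h3
    exact Nat.ModEq.eq_of_lt_of_lt h2 hx.1 hy.1
lemma comp_conn {V : Type*} {G : SimpleGraph V} {R : V → Set (ℤ × ℤ)}
    (hconn : ∀ v, ∀ a ∈ R v, ∀ b ∈ R v, Conn (R v) a b)
    (hadj : ∀ u v, G.Adj u v → (R u ∩ R v).Nonempty) {S : Set V} {g v : V}
    (hv : v ∈ comp G S g) {a b} (ha : a ∈ R g) (hb : b ∈ R v) :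
    Conn (⋃ u ∈ comp G S g, R u) a b := by
  have hv' : Relation.ReflTransGen (del G S).Adj g v := by
    rw [← SimpleGraph.reachable_iff_reflTransGen]; exact hv
  have hsub : ∀ u, Relation.ReflTransGen (del G S).Adj g u → R u ⊆ ⋃ u ∈ comp G S g, R u := by
    intro u hu
    refine Set.subset_biUnion_of_mem (u := R) ?_
    show (del G S).Reachable g u
    rw [SimpleGraph.reachable_iff_reflTransGen]; exact hu
  clear hv
  induction hv' generalizing b with
  | refl => exact (hconn g a ha b hb).mono (hsub _ .refl)
  | @tail y z hy hz ih =>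
    obtain ⟨c, hc1, hc2⟩ := hadj y z hz.1
    exact (ih hc1).trans ((hconn z c hc2 b hb).mono (hsub z (hy.tail hz)))

theorem topo {V : Type*} [Fintype V] (G : SimpleGraph V) (R : V → Set (ℤ × ℤ))
    (hne : ∀ v, (R v).Nonempty)
    (hconn : ∀ v, ∀ a ∈ R v, ∀ b ∈ R v, Conn (R v) a b)
    (K : ℕ) (hK : ∀ v, ∀ p ∈ R v, |p.1| < K ∧ |p.2| < K)
    (hadj : ∀ u v, G.Adj u v → (R u ∩ R v).Nonempty)
    (S1 : Set V) (T : ℤ × ℤ → Set V) (A : ℤ × ℤ → Set (ℤ × ℤ)) (b0 : ℤ × ℤ)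
    (hA : ∀ p, Conn (A p) b0 p)
    (hdisj : ∀ p S g, S1 ⊆ S → T p ⊆ S → Giant G S g → ∀ u ∈ comp G S g, ∀ x ∈ R u, x ∉ A p)
    (hgiant : ∀ p q r s, ∃ g, Giant G (S1 ∪ T p ∪ T q ∪ T r ∪ T s) g)
    (hout : ∀ p q : ℤ × ℤ, ((K : ℤ) ≤ |p.1| ∨ (K : ℤ) ≤ |p.2|) → ((K : ℤ) ≤ |q.1| ∨ (K : ℤ) ≤ |q.2|) → T p = T q) :
    False := by
  choose φ hφ using fun p => exists_fill (hA p)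
  choose g hg using hgiant
  choose x hx using hne
  let ε : ℤ × ℤ → ℤ × ℤ → ZMod 2 := fun p q =>
    φ p (x (g p q p q)) + φ q (x (g p q p q)) + cr p q (x (g p q p q))
  have key : ∀ p q S g' y, gAdj p q → S1 ⊆ S → T p ⊆ S → T q ⊆ S → Giant G S g' → y ∈ R g' →
      ε p q = φ p y + φ q y + cr p q y := by
    intro p q S g' y hpq h1 hp hq hg' hy
    have hG := hg p q p q
    have hsub := giant_nest (S' := S) (by intro v hv; simp only [Set.mem_union] at hv; rcases hv with (((h | h) | h) | h) | h; exacts [h1 h, hp h, hq h, hp h, hq h]) hG hg'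
    have hmem : g' ∈ comp G (S1 ∪ T p ∪ T q ∪ T p ∪ T q) (g p q p q) :=
      hsub (SimpleGraph.Reachable.refl _)
    have hc := comp_conn hconn hadj hmem (hx _) hy
    refine X_const (hφ p) (hφ q) hpq (hA p).right (hA q).right ?_ hc
    intro z hz
    simp only [Set.mem_iUnion] at hz
    obtain ⟨u, hu, hz⟩ := hz
    exact ⟨hdisj p _ _ (by intro v hv; simp [hv]) (by intro v hv; simp [hv]) hG u hu z hz,
      hdisj q _ _ (by intro v hv; simp [hv]) (by intro v hv; simp [hv]) hG u hu z hz⟩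
  let po : ℤ × ℤ := (K, K)
  have hpo : (K : ℤ) ≤ |po.1| ∨ (K : ℤ) ≤ |po.2| := Or.inl (le_abs_self _)
  refine box_contra ε K (fun p => φ p (x (g po po po po))) (x (g po po po po)) (hK _ _ (hx _)) ?_ ?_
  · intro a b
    have hG := hg (a,b) (a+1,b) (a+1,b+1) (a,b+1)
    set S := S1 ∪ T (a,b) ∪ T (a+1,b) ∪ T (a+1,b+1) ∪ T (a,b+1) with hS
    have s0 : S1 ⊆ S := by intro v hv; simp [hS, hv]
    have s1 : T (a,b) ⊆ S := by intro v hv; simp [hS, hv]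
    have s2 : T (a+1,b) ⊆ S := by intro v hv; simp [hS, hv]
    have s3 : T (a+1,b+1) ⊆ S := by intro v hv; simp [hS, hv]
    have s4 : T (a,b+1) ⊆ S := by intro v hv; simp [hS, hv]
    set h := g (a,b) (a+1,b) (a+1,b+1) (a,b+1)
    rw [key _ _ S h (x h) (by simp [gAdj]) s0 s1 s2 hG (hx _),
      key _ _ S h (x h) (by simp [gAdj]) s0 s2 s3 hG (hx _),
      key _ _ S h (x h) (by simp [gAdj]) s0 s4 s3 hG (hx _),
      key _ _ S h (x h) (by simp [gAdj]) s0 s1 s4 hG (hx _)]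
    have hne : x h ≠ (a,b) := by
      intro he
      exact hdisj (a,b) S h s0 s1 hG h (SimpleGraph.Reachable.refl _) (x h) (hx h) (he ▸ (hA (a,b)).right)
    have e := cr_square hne
    set y := x h
    linear_combination e + two_zero (φ (a,b) y) + two_zero (φ (a+1,b) y) + two_zero (φ (a+1,b+1) y) + two_zero (φ (a,b+1) y)
  · intro p q hpq hp hq
    refine key p q (S1 ∪ T po ∪ T po ∪ T po ∪ T po) _ _ hpq ?_ ?_ ?_ (hg po po po po) (hx _)
    · intro v hv; simp [hv]
    · rw [hout p po hp hpo]; intro v hv; simp [hv]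
    · rw [hout q po hq hpo]; intro v hv; simp [hv]

lemma vseg {A : Set (ℤ × ℤ)} (x y : ℤ) (n : ℕ) (h : ∀ i : ℕ, i ≤ n → (x, y + i) ∈ A) :
    Conn A (x, y) (x, y + n) := by
  induction n with
  | zero => simpa using Conn.refl (by simpa using h 0 le_rfl)
  | succ n ih => exact (ih fun i hi => h i (by omega)).step (by simp [gAdj, add_assoc]) (h _ le_rfl)

lemma hseg {A : Set (ℤ × ℤ)} (x y : ℤ) (n : ℕ) (h : ∀ i : ℕ, i ≤ n → (x + i, y) ∈ A) :
    Conn A (x, y) (x + n, y) := by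
  induction n with
  | zero => simpa using Conn.refl (by simpa using h 0 le_rfl)
  | succ n ih => exact (ih fun i hi => h i (by omega)).step (by simp [gAdj, add_assoc]) (h _ le_rfl)

lemma vseg2 {A : Set (ℤ × ℤ)} (x y y' : ℤ) (h : ∀ z, (x, z) ∈ A) : Conn A (x, y) (x, y') := by
  rcases le_total y y' with hl | hl
  · have := vseg (A := A) x y (y' - y).toNat (fun i _ => h _)
    rwa [Int.toNat_of_nonneg (by omega), add_sub_cancel] at this
  · have := vseg (A := A) x y' (y - y').toNat (fun i _ => h _)
    rw [Int.toNat_of_nonneg (by omega), add_sub_cancel] at this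
    exact this.symm

lemma hseg2 {A : Set (ℤ × ℤ)} (x x' y : ℤ) (h : ∀ z, (z, y) ∈ A) : Conn A (x, y) (x', y) := by
  rcases le_total x x' with hl | hl
  · have := hseg (A := A) x y (x' - x).toNat (fun i _ => h _)
    rwa [Int.toNat_of_nonneg (by omega), add_sub_cancel] at this
  · have := hseg (A := A) x' y (x - x').toNat (fun i _ => h _)
    rw [Int.toNat_of_nonneg (by omega), add_sub_cancel] at this
    exact this.symm

lemma conn_univ (p q : ℤ × ℤ) : Conn Set.univ p q :=
  (vseg2 p.1 p.2 q.2 fun _ => Set.mem_univ _).trans (hseg2 p.1 q.1 q.2 fun _ => Set.mem_univ _)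

def Out (K : ℕ) : Set (ℤ × ℤ) := {p | (K : ℤ) ≤ |p.1| ∨ (K : ℤ) ≤ |p.2|}

lemma conn_out1 (K : ℕ) (p : ℤ × ℤ) (hp : p ∈ Out K) : Conn (Out K) p (K, K) := by
  obtain ⟨x, y⟩ := p
  rcases hp with h | h
  · exact (vseg2 x y K fun z => Or.inl h).trans (hseg2 x K K fun z => Or.inr (le_abs_self _))
  · exact (hseg2 x K y fun z => Or.inr h).trans (vseg2 K y K fun z => Or.inl (le_abs_self _))

lemma exists_sigma {V : Type*} (R : V → Set (ℤ × ℤ)) (Q : Set V) (ρ : V) (hρ : ρ ∈ Q)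
    (hne : (R ρ).Nonempty) (K : ℕ) (hK : ∀ v, ∀ p ∈ R v, |p.1| < K ∧ |p.2| < K) :
    ∃ σ : ℤ × ℤ → V, (∀ p, σ p ∈ Q ∧ ∃ a ∈ R (σ p), Conn (R (σ p) ∪ {q | ∀ v ∈ Q, q ∉ R v}) a p) ∧
      ∀ p ∈ Out K, ∀ q ∈ Out K, σ p = σ q := by
  classical
  set U : Set (ℤ × ℤ) := {q | ∀ v ∈ Q, q ∉ R v} with hU
  have ex : ∀ p, ∃ v, v ∈ Q ∧ ∃ a ∈ R v, Conn (R v ∪ U) a p := by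
    intro p
    obtain ⟨b0, hb0⟩ := hne
    obtain ⟨-, h⟩ := conn_univ b0 p
    induction h with
    | refl => exact ⟨ρ, hρ, b0, hb0, Conn.refl (Or.inl hb0)⟩
    | @tail y z hy hz ih =>
      by_cases hc : ∃ v ∈ Q, z ∈ R v
      · obtain ⟨v, hv, hzv⟩ := hc
        exact ⟨v, hv, z, hzv, Conn.refl (Or.inl hzv)⟩
      · obtain ⟨v, hv, a, ha, hcn⟩ := ih
        refine ⟨v, hv, a, ha, hcn.step hz.1 (Or.inr ?_)⟩
        intro v hv hzv
        exact hc ⟨v, hv, hzv⟩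
  have hOU : Out K ⊆ U := by
    intro p hp v hv hpv
    have := hK v p hpv
    rcases hp with h | h <;> omega
  choose σ hσ using ex
  refine ⟨fun p => if p ∈ Out K then σ (K, K) else σ p, fun p => ?_, fun p hp q hq => by simp [hp, hq]⟩
  by_cases hp : p ∈ Out K
  · simp only [hp, if_true]
    obtain ⟨h1, a, ha, h2⟩ := hσ (K, K)
    exact ⟨h1, a, ha, h2.trans ((conn_out1 K p hp).symm.mono (fun x hx => Or.inr (hOU hx)))⟩
  · simp only [hp, if_false]; exact hσ p

lemma cost {V : Type*} [Fintype V] (G0 : SimpleGraph V) (R : V → Set (ℤ × ℤ))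
    (hconn : ∀ v, ∀ a ∈ R v, ∀ b ∈ R v, Conn (R v) a b)
    (hadj : ∀ u v, G0.Adj u v → (R u ∩ R v).Nonempty)
    (ρ : V) (w d : V → ℕ) (hw0 : ∀ v, 0 < w v)
    (hd2 : ∀ v, G0.Reachable v ρ → (v = ρ ∧ d v = w v) ∨ ∃ u, G0.Adj v u ∧ G0.Reachable u ρ ∧ d v = d u + w v)
    (Band : V → Prop) (L k b : ℕ) (hb : b < L) (hw : ∀ v, G0.Reachable v ρ → w v ≤ L)
    (hcard : ∀ v, G0.Reachable v ρ → {u | Band u ∧ (R u ∩ R v).Nonempty}.ncard ≤ w v)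
    (hband : ∀ u v, Band u → (R u ∩ R v).Nonempty → G0.Reachable v ρ →
      k * L ≤ d v + b ∧ d v - w v + b < (k + 1) * L)
    (b0 : ℤ × ℤ) (hb0 : b0 ∈ R ρ) :
    ∀ n v, d v = n → G0.Reachable v ρ → ∃ K : Set V, v ∈ K ∧ (∀ x ∈ K, G0.Reachable x ρ) ∧
      (∀ p ∈ R v, Conn (⋃ x ∈ K, R x) b0 p) ∧
      {u | Band u ∧ ∃ x ∈ K, (R u ∩ R x).Nonempty}.ncard + k * L ≤
        max (k * L) (min (d v + b) ((k + 1) * L + L) + L) := by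
  intro n
  induction n using Nat.strong_induction_on with
  | _ n ih =>
  intro v hvn hv
  have hc := hcard v hv
  have hwv := hw v hv
  have hw0v := hw0 v
  have hbd : 0 < {u | Band u ∧ (R u ∩ R v).Nonempty}.ncard →
      k * L ≤ d v + b ∧ d v - w v + b < (k + 1) * L := by
    intro h
    obtain ⟨u, hu⟩ := Set.nonempty_of_ncard_ne_zero h.ne'
    exact hband u v hu.1 hu.2 hv
  have hkk : (k + 1) * L = k * L + L := by ring
  rcases hd2 v hv with ⟨rfl, hdv⟩ | ⟨u, huv, hu, hdu⟩
  · refine ⟨{v}, rfl, by simp [hv], ?_, ?_⟩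
    · intro p hp; simpa using hconn v b0 hb0 p hp
    · simp only [Set.mem_singleton_iff, exists_eq_left]
      omega
  · obtain ⟨K, hK1, hK2, hK3, hK4⟩ := ih (d u) (by omega) u rfl hu
    refine ⟨insert v K, Set.mem_insert _ _, ?_, ?_, ?_⟩
    · rintro x (rfl | hx)
      · exact hv
      · exact hK2 x hx
    · intro p hp
      obtain ⟨c, hc1, hc2⟩ := hadj v u huv
      have h1 := hK3 c hc2
      rw [Set.biUnion_insert]
      exact (h1.mono Set.subset_union_right).trans ((hconn v c hc1 p hp).mono Set.subset_union_left)
    · have hsub : {u | Band u ∧ ∃ x ∈ insert v K, (R u ∩ R x).Nonempty} ⊆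
          {u | Band u ∧ ∃ x ∈ K, (R u ∩ R x).Nonempty} ∪ {u | Band u ∧ (R u ∩ R v).Nonempty} := by
        rintro y ⟨hy, x, hx | hx, hxy⟩
        · subst hx; exact Or.inr ⟨hy, hxy⟩
        · exact Or.inl ⟨hy, x, hx, hxy⟩
      have h1 := Set.ncard_le_ncard hsub (Set.toFinite _)
      have h2 := Set.ncard_union_le {u | Band u ∧ ∃ x ∈ K, (R u ∩ R x).Nonempty} {u | Band u ∧ (R u ∩ R v).Nonempty}
      omega
theorem haven_false {V : Type*} [Fintype V] (G : SimpleGraph V) (R : V → Set (ℤ × ℤ))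
    (hne : ∀ v, (R v).Nonempty)
    (hconn : ∀ v, ∀ a ∈ R v, ∀ b ∈ R v, Conn (R v) a b)
    (K : ℕ) (hK : ∀ v, ∀ p ∈ R v, |p.1| < K ∧ |p.2| < K)
    (hadj : ∀ u v, G.Adj u v ↔ u ≠ v ∧ (R u ∩ R v).Nonempty)
    (L : ℕ) (hL : G.edgeSet.ncard < L * L)
    (haven : ∀ S : Set V, S.ncard ≤ 18 * L → ∃ g, Giant G S g) : False := by
  classical
  have hL0 : 0 < L := by
    rcases Nat.eq_zero_or_pos L with h | h
    · subst h; simp at hL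
    · exact h
  set m := G.edgeSet.ncard with hm
  have hm' : G.edgeFinset.card = m := by
    rw [hm, Set.ncard_eq_toFinset_card']; rfl
  have hdeg : ∑ v, G.degree v = 2 * m := by
    rw [SimpleGraph.sum_degrees_eq_twice_card_edges, hm']
  have hadj' : ∀ u v, G.Adj u v → (R u ∩ R v).Nonempty := fun u v h => ((hadj u v).1 h).2
  -- high degree vertices
  set F0 : Finset V := Finset.univ.filter fun v => L ≤ G.degree v with hF0
  have hF0c : F0.card * L ≤ 2 * m := by
    rw [← hdeg, ← smul_eq_mul]
    refine (Finset.card_nsmul_le_sum F0 (fun v => G.degree v) L ?_).trans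
      (Finset.sum_le_sum_of_subset (Finset.subset_univ _))
    intro v hv
    simpa [hF0] using hv
  have hF0c' : F0.card < 2 * L := by
    by_contra hc
    push Not at hc
    have := Nat.mul_le_mul_right L hc
    nlinarith
  let w : V → ℕ := fun v => G.degree v + 1
  obtain ⟨ρ, hρ⟩ := haven (F0 : Set V) (by rw [Set.ncard_coe_finset]; omega)
  set G0 := del G (F0 : Set V) with hG0
  obtain ⟨d, hd1, hd2⟩ := exists_dist G0 ρ w
  have hrF : ∀ v, G0.Reachable v ρ → v ∉ F0 := fun v hv => by
    have := comp_notMem hρ.1 (show v ∈ comp G F0 ρ from hv.symm)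
    simpa using this
  have hdw : ∀ v, G0.Reachable v ρ → w v ≤ d v := by
    intro v hv
    rcases hd2 v hv with h | ⟨u, h⟩ <;> omega
  have hwL : ∀ v, G0.Reachable v ρ → w v ≤ L := by
    intro v hv
    have := hrF v hv
    simp only [hF0, Finset.mem_filter, Finset.mem_univ, true_and] at this
    show G.degree v + 1 ≤ L
    omega
  -- choose the shift
  let Z : ℕ → Finset V := fun b => Finset.univ.filter fun v =>
    0 < G.degree v ∧ (d v - w v + b) / L ≠ (d v - w v + w v + b) / L
  have hZ : ∑ b ∈ Finset.range L, (Z b).card ≤ 4 * m := by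
    have e1 : ∑ b ∈ Finset.range L, (Z b).card =
        ∑ v : V, ((Finset.range L).filter fun b =>
          0 < G.degree v ∧ (d v - w v + b) / L ≠ (d v - w v + w v + b) / L).card := by
      simp only [Z, Finset.card_filter]
      exact Finset.sum_comm
    rw [e1]
    have e2 : 4 * m = ∑ v, 2 * G.degree v := by rw [← Finset.mul_sum, hdeg]; ring
    rw [e2]
    refine Finset.sum_le_sum fun v _ => ?_
    rcases Nat.eq_zero_or_pos (G.degree v) with h | h
    · simp [h]
    · simp only [h, true_and]
      have := count_shift L hL0 (d v - w v) (w v)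
      have hwv : w v = G.degree v + 1 := rfl
      omega
  have hb : ∃ b < L, (Z b).card < 4 * L := by
    by_contra hc
    push Not at hc
    have := Finset.card_nsmul_le_sum (Finset.range L) (fun b => (Z b).card) (4 * L)
      (fun b hb => hc b (Finset.mem_range.1 hb))
    simp only [Finset.card_range, smul_eq_mul] at this
    nlinarith
  obtain ⟨b, hbL, hZb⟩ := hb
  set S1 : Set V := (F0 : Set V) ∪ (Z b : Set V) with hS1
  have hS1c : S1.ncard ≤ 6 * L := by
    have := Set.ncard_union_le (F0 : Set V) (Z b : Set V)
    rw [Set.ncard_coe_finset, Set.ncard_coe_finset] at this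
    exact this.trans (by omega)
  obtain ⟨g1, hg1⟩ := haven S1 (by omega)
  set k := (d g1 + b) / L with hk
  let Band : V → Prop := fun u => u ∉ S1 ∧ G0.Reachable u ρ ∧ (d u - w u + b) / L = k ∧ (d u + b) / L = k
  have hnest : comp G S1 g1 ⊆ comp G F0 ρ := giant_nest Set.subset_union_left hρ hg1
  have hcompBand : ∀ u ∈ comp G S1 g1, Band u := by
    have h0 : ∀ u ∈ comp G S1 g1, u ∉ S1 ∧ G0.Reachable u ρ ∧ (d u - w u + b) / L = (d u + b) / L := by
      intro u hu
      have h1 := comp_notMem hg1.1 hu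
      have h2 : G0.Reachable u ρ := (show G0.Reachable ρ u from hnest hu).symm
      refine ⟨h1, h2, ?_⟩
      obtain ⟨x, hx⟩ := giant_nbr hg1 hu
      have h3 : 0 < G.degree u := (G.degree_pos_iff_exists_adj u).2 ⟨x, hx⟩
      have h4 : u ∉ Z b := fun h => h1 (Or.inr h)
      simp only [Z, Finset.mem_filter, Finset.mem_univ, h3, true_and, not_not] at h4
      rwa [Nat.sub_add_cancel (hdw u h2)] at h4
    have h5 : ∀ u ∈ comp G S1 g1, (d u + b) / L = k := by
      intro u hu
      have hu' : Relation.ReflTransGen (del G S1).Adj g1 u := by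
        rw [← SimpleGraph.reachable_iff_reflTransGen]; exact hu
      clear hu
      induction hu' with
      | refl => rfl
      | @tail y z hy hz ih =>
        have hyc : y ∈ comp G S1 g1 := by
          show (del G S1).Reachable g1 y
          rw [SimpleGraph.reachable_iff_reflTransGen]; exact hy
        have hzc : z ∈ comp G S1 g1 := by
          show (del G S1).Reachable g1 z
          rw [SimpleGraph.reachable_iff_reflTransGen]; exact hy.tail hz
        obtain ⟨y1, y2, y3⟩ := h0 y hyc
        obtain ⟨z1, z2, z3⟩ := h0 z hzc
        have hyz : G0.Adj y z := ⟨hz.1, fun h => y1 (Or.inl h), fun h => z1 (Or.inl h)⟩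
        have a1 := hd1 y z hyz z2
        have a2 := hd1 z y hyz.symm y2
        have b1 : (d y - w y + b) / L ≤ (d z + b) / L := Nat.div_le_div_right (by omega)
        have b2 : (d z - w z + b) / L ≤ (d y + b) / L := Nat.div_le_div_right (by omega)
        omega
    intro u hu
    obtain ⟨x1, x2, x3⟩ := h0 u hu
    exact ⟨x1, x2, x3.trans (h5 u hu), h5 u hu⟩
  obtain ⟨b0, hb0⟩ := hne ρ
  have hcost := cost G0 R hconn (fun u v h => hadj' u v h.1) ρ w d (fun v => Nat.succ_pos _) hd2
    Band L k b hbL hwL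
    (by
      intro v hv
      have hsub : {u | Band u ∧ (R u ∩ R v).Nonempty} ⊆ ((insert v (G.neighborFinset v) : Finset V) : Set V) := by
        rintro u ⟨-, hu⟩
        by_cases h : u = v
        · simp [h]
        · have : G.Adj v u := ((hadj u v).2 ⟨h, hu⟩).symm
          simp [this]
      refine (Set.ncard_le_ncard hsub (Set.toFinite _)).trans ?_
      rw [Set.ncard_coe_finset]
      exact (Finset.card_insert_le _ _))
    (by
      rintro u v ⟨u1, u2, u3, u4⟩ huv hv
      have c1 : k * L ≤ d u - w u + b := by rw [← u3]; exact Nat.div_mul_le_self _ _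
      have c2 : d u + b < (k + 1) * L := by
        rw [← u4]; exact Nat.lt_mul_of_div_lt (Nat.lt_succ_self _) hL0
      by_cases h : u = v
      · subst h; omega
      · have hA : G0.Adj u v := ⟨(hadj u v).2 ⟨h, huv⟩, hrF u u2, hrF v hv⟩
        have a1 := hd1 u v hA hv
        have a2 := hd1 v u hA.symm u2
        omega)
    b0 hb0
  have hcost' : ∀ v, ∃ Kv : Set V, G0.Reachable v ρ → (v ∈ Kv ∧ (∀ x ∈ Kv, G0.Reachable x ρ) ∧
      (∀ p ∈ R v, Conn (⋃ x ∈ Kv, R x) b0 p) ∧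
      {u | Band u ∧ ∃ x ∈ Kv, (R u ∩ R x).Nonempty}.ncard ≤ 3 * L) := by
    intro v
    by_cases hv : G0.Reachable v ρ
    · obtain ⟨Kv, k1, k2, k3, k4⟩ := hcost (d v) v rfl hv
      refine ⟨Kv, fun _ => ⟨k1, k2, k3, ?_⟩⟩
      have hkk : (k + 1) * L = k * L + L := by ring
      omega
    · exact ⟨∅, fun h => absurd h hv⟩
  choose Kf hKf using hcost'
  obtain ⟨σ, hσ1, hσ2⟩ := exists_sigma R {v | G0.Reachable v ρ} ρ (SimpleGraph.Reachable.refl _) (hne ρ) K hK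
  set U : Set (ℤ × ℤ) := {q | ∀ v ∈ {v | G0.Reachable v ρ}, q ∉ R v} with hU
  let T : ℤ × ℤ → Set V := fun p => {u | Band u ∧ ∃ x ∈ Kf (σ p), (R u ∩ R x).Nonempty}
  have hTc : ∀ p, (T p).ncard ≤ 3 * L := fun p => (hKf (σ p) (hσ1 p).1).2.2.2
  refine topo G R hne hconn K hK hadj' S1 T (fun p => (⋃ x ∈ Kf (σ p), R x) ∪ U) b0 ?_ ?_ ?_ ?_
  · intro p
    obtain ⟨h1, a, ha, h2⟩ := hσ1 p
    obtain ⟨k1, k2, k3, k4⟩ := hKf (σ p) h1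
    refine ((k3 a ha).mono Set.subset_union_left).trans (h2.mono ?_)
    exact Set.union_subset_union_left _ (Set.subset_biUnion_of_mem (u := R) k1)
  · intro p S g hS hT hg u hu x hx hxA
    have hB := hcompBand u (giant_nest hS hg1 hg hu)
    have huS := comp_notMem hg.1 hu
    rcases hxA with h | h
    · simp only [Set.mem_iUnion] at h
      obtain ⟨y, hy, hxy⟩ := h
      exact huS (hT ⟨hB, y, hy, x, hx, hxy⟩)
    · exact h u hB.2.1 hx
  · intro p q r s
    apply haven
    have e1 := Set.ncard_union_le (S1 ∪ T p ∪ T q ∪ T r) (T s)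
    have e2 := Set.ncard_union_le (S1 ∪ T p ∪ T q) (T r)
    have e3 := Set.ncard_union_le (S1 ∪ T p) (T q)
    have e4 := Set.ncard_union_le S1 (T p)
    have := hTc p
    have := hTc q
    have := hTc r
    have := hTc s
    omega
  · intro p q hp hq
    have := hσ2 p hp q hq
    simp only [T, this]
def Blk (q : ℤ × ℤ) : Set (ℤ × ℤ) := {p | |p.1 - q.1| ≤ 1 ∧ |p.2 - q.2| ≤ 1}

lemma blk_conn {p q : ℤ × ℤ} (h : p ∈ Blk q) : Conn (Blk q) p q := by
  obtain ⟨x, y⟩ := p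
  obtain ⟨a, b⟩ := q
  have h' := h
  obtain ⟨h1, h2⟩ := h
  simp only at h1 h2
  have hm : ((a, y) : ℤ × ℤ) ∈ Blk (a, b) := ⟨by simp, h2⟩
  have hq : ((a, b) : ℤ × ℤ) ∈ Blk (a, b) := ⟨by simp, by simp⟩
  have c1 : Conn (Blk (a, b)) (x, y) (a, y) := by
    by_cases he : x = a
    · subst he; exact Conn.refl h'
    · refine (Conn.refl h').step ?_ hm
      simp only [gAdj, true_and]; rw [abs_le] at h1; omega
  have c2 : Conn (Blk (a, b)) (a, y) (a, b) := by
    by_cases he : y = b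
    · subst he; exact Conn.refl hm
    · refine (Conn.refl hm).step ?_ hq
      simp only [gAdj, true_and]; rw [abs_le] at h2; omega
  exact c1.trans c2

noncomputable def fl (δ : ℝ) (z : ℝ × ℝ) : ℤ × ℤ := (⌊z.1 / δ⌋, ⌊z.2 / δ⌋)

lemma floor_near {a b : ℝ} (h : |a - b| < 1) : |⌊a⌋ - ⌊b⌋| ≤ 1 := by
  rw [abs_lt] at h
  have h1 := Int.floor_le a
  have h2 := Int.lt_floor_add_one a
  have h3 := Int.floor_le b
  have h4 := Int.lt_floor_add_one b
  rw [abs_le]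
  constructor
  · have : ((⌊b⌋ : ℤ) : ℝ) < ((⌊a⌋ + 2 : ℤ) : ℝ) := by push_cast; linarith
    have := Int.cast_lt.1 this; omega
  · have : ((⌊a⌋ : ℤ) : ℝ) < ((⌊b⌋ + 2 : ℤ) : ℝ) := by push_cast; linarith
    have := Int.cast_lt.1 this; omega

lemma floor_far {a b : ℝ} {p : ℤ} (h : |p - ⌊a⌋| ≤ 1) (h' : |p - ⌊b⌋| ≤ 1) : |a - b| < 10 := by
  rw [abs_le] at h h'
  have h1 := Int.floor_le a
  have h2 := Int.lt_floor_add_one a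
  have h3 := Int.floor_le b
  have h4 := Int.lt_floor_add_one b
  have e1 : ((⌊a⌋ : ℤ) : ℝ) ≤ ((⌊b⌋ + 2 : ℤ) : ℝ) := Int.cast_le.2 (by omega)
  have e2 : ((⌊b⌋ : ℤ) : ℝ) ≤ ((⌊a⌋ + 2 : ℤ) : ℝ) := Int.cast_le.2 (by omega)
  push_cast at e1 e2
  rw [abs_lt]; constructor <;> linarith

lemma fl_near {δ : ℝ} (hδ : 0 < δ) {x y : ℝ × ℝ} (h : dist x y < δ) : fl δ x ∈ Blk (fl δ y) := by
  rw [Prod.dist_eq, max_lt_iff, Real.dist_eq, Real.dist_eq] at h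
  refine ⟨floor_near ?_, floor_near ?_⟩
  · rw [← sub_div, abs_div, abs_of_pos hδ, div_lt_one hδ]; exact h.1
  · rw [← sub_div, abs_div, abs_of_pos hδ, div_lt_one hδ]; exact h.2

lemma fl_far {δ : ℝ} (hδ : 0 < δ) {x y : ℝ × ℝ} {p} (h : p ∈ Blk (fl δ x)) (h' : p ∈ Blk (fl δ y)) :
    dist x y < 10 * δ := by
  rw [Prod.dist_eq, max_lt_iff, Real.dist_eq, Real.dist_eq]
  have e1 := floor_far h.1 h'.1
  have e2 := floor_far h.2 h'.2
  rw [← sub_div, abs_div, abs_of_pos hδ, div_lt_iff₀ hδ] at e1 e2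
  exact ⟨e1, e2⟩

theorem discretize {V : Type*} [Fintype V] (G : SimpleGraph V) (c : V → ℝ → ℝ × ℝ)
    (hc : ∀ v, ContinuousOn (c v) (Set.Icc 0 1))
    (hG : ∀ u v : V, G.Adj u v ↔ u ≠ v ∧ (c u '' Set.Icc 0 1 ∩ c v '' Set.Icc 0 1).Nonempty) :
    ∃ R : V → Set (ℤ × ℤ), (∀ v, (R v).Nonempty) ∧
      (∀ v, ∀ a ∈ R v, ∀ b ∈ R v, Conn (R v) a b) ∧
      (∃ K : ℕ, ∀ v, ∀ p ∈ R v, |p.1| < K ∧ |p.2| < K) ∧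
      (∀ u v, G.Adj u v ↔ u ≠ v ∧ (R u ∩ R v).Nonempty) := by
  have hcomp : ∀ v, IsCompact (c v '' Set.Icc 0 1) := fun v => isCompact_Icc.image_of_continuousOn (hc v)
  have hr : ∀ i : V × V, ∃ r : ℝ, 0 < r ∧ (Disjoint (c i.1 '' Set.Icc 0 1) (c i.2 '' Set.Icc 0 1) →
      ∀ x ∈ c i.1 '' Set.Icc 0 1, ∀ y ∈ c i.2 '' Set.Icc 0 1, r < dist x y) := by
    intro i
    by_cases hd : Disjoint (c i.1 '' Set.Icc 0 1) (c i.2 '' Set.Icc 0 1)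
    · obtain ⟨r, hr, h⟩ := Metric.exists_pos_forall_lt_edist (hcomp i.1) (hcomp i.2).isClosed hd
      refine ⟨r, by exact_mod_cast hr, fun _ x hx y hy => ?_⟩
      have := h x hx y hy
      rw [edist_nndist] at this
      exact_mod_cast this
    · exact ⟨1, one_pos, fun h => absurd h hd⟩
  choose r hr0 hr using hr
  obtain ⟨δ, hδ0, hδ⟩ : ∃ δ : ℝ, 0 < δ ∧ ∀ i, 10 * δ < r i := by
    have h1 : ∀ᶠ δ in nhdsWithin (0:ℝ) (Set.Ioi 0), ∀ i, δ < r i / 10 :=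
      Filter.eventually_all.2 fun i => by
        have := Ioo_mem_nhdsGT (show (0:ℝ) < r i / 10 by have := hr0 i; positivity)
        filter_upwards [this] with x hx using hx.2
    obtain ⟨δ, h2, h3⟩ := (h1.and self_mem_nhdsWithin).exists
    exact ⟨δ, h3, fun i => by have := h2 i; linarith⟩
  let R : V → Set (ℤ × ℤ) := fun v => ⋃ t ∈ Set.Icc (0:ℝ) 1, Blk (fl δ (c v t))
  have hsub : ∀ v, ∀ t ∈ Set.Icc (0:ℝ) 1, Blk (fl δ (c v t)) ⊆ R v := fun v t ht =>
    Set.subset_biUnion_of_mem (u := fun t => Blk (fl δ (c v t))) ht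
  have hself : ∀ q, q ∈ Blk q := fun q => ⟨by simp, by simp⟩
  refine ⟨R, ?_, ?_, ?_, ?_⟩
  · intro v
    exact ⟨_, hsub v 0 ⟨le_rfl, zero_le_one⟩ (hself _)⟩
  · intro v
    have hP : ∀ s ∈ Set.Icc (0:ℝ) 1, ∀ t ∈ Set.Icc (0:ℝ) 1, Conn (R v) (fl δ (c v s)) (fl δ (c v t)) := by
      intro s hs t ht
      refine isPreconnected_Icc.induction₂ (fun s t => Conn (R v) (fl δ (c v s)) (fl δ (c v t)))
        ?_ ?_ ?_ hs ht
      · intro x hx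
        have h1 := (hc v x hx).eventually (Metric.ball_mem_nhds (c v x) hδ0)
        filter_upwards [h1] with y hy
        exact (blk_conn (fl_near hδ0 hy)).symm.mono (hsub v x hx)
      · intro x y z _ _ _ h1 h2; exact h1.trans h2
      · intro x y _ _ h; exact h.symm
    intro a ha b hb
    simp only [R, Set.mem_iUnion] at ha hb
    obtain ⟨s, hs, ha⟩ := ha
    obtain ⟨t, ht, hb⟩ := hb
    exact (((blk_conn ha).mono (hsub v s hs)).trans (hP s hs t ht)).trans ((blk_conn hb).mono (hsub v t ht)).symm
  · have hM : ∃ M : ℝ, ∀ v, ∀ t ∈ Set.Icc (0:ℝ) 1, ‖c v t‖ ≤ M := by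
      have : Bornology.IsBounded (⋃ v, c v '' Set.Icc (0:ℝ) 1) :=
        (isCompact_iUnion hcomp).isBounded
      obtain ⟨M, hM⟩ := this.exists_norm_le
      exact ⟨M, fun v t ht => hM _ (Set.mem_iUnion.2 ⟨v, t, ht, rfl⟩)⟩
    obtain ⟨M, hM⟩ := hM
    obtain ⟨N, hN⟩ := exists_nat_gt (M / δ)
    have aux : ∀ (z : ℝ) (p : ℤ), |z| ≤ M → |p - ⌊z / δ⌋| ≤ 1 → |p| < ((N + 3 : ℕ) : ℤ) := by
      intro z p hz hp
      have h0 : |z / δ| ≤ M / δ := by rw [abs_div, abs_of_pos hδ0]; gcongr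
      rw [abs_le] at h0 hp
      have h1 := Int.floor_le (z / δ)
      have h2 := Int.lt_floor_add_one (z / δ)
      have e1 : ((⌊z / δ⌋ : ℤ) : ℝ) < ((N : ℤ) : ℝ) := by push_cast; linarith
      have e2 : ((-N : ℤ) : ℝ) < ((⌊z / δ⌋ + 1 : ℤ) : ℝ) := by push_cast; linarith
      have e1 := Int.cast_lt.1 e1
      have e2 := Int.cast_lt.1 e2
      rw [abs_lt]; push_cast; omega
    refine ⟨N + 3, fun v p hp => ?_⟩
    simp only [R, Set.mem_iUnion] at hp
    obtain ⟨t, ht, hp⟩ := hp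
    have hn := hM v t ht
    rw [Prod.norm_def, max_le_iff, Real.norm_eq_abs, Real.norm_eq_abs] at hn
    exact ⟨aux _ _ hn.1 hp.1, aux _ _ hn.2 hp.2⟩
  · intro u v
    rw [hG]
    refine and_congr_right fun _ => ⟨?_, ?_⟩
    · rintro ⟨z, ⟨s, hs, rfl⟩, ⟨t, ht, hz⟩⟩
      exact ⟨fl δ (c u s), hsub u s hs (hself _), hsub v t ht (by rw [hz]; exact hself _)⟩
    · rintro ⟨p, hp1, hp2⟩
      by_contra hcon
      have hd : Disjoint (c u '' Set.Icc 0 1) (c v '' Set.Icc 0 1) := by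
        rw [Set.disjoint_iff_inter_eq_empty]; exact Set.not_nonempty_iff_eq_empty.1 hcon
      simp only [R, Set.mem_iUnion] at hp1 hp2
      obtain ⟨s, hs, hp1⟩ := hp1
      obtain ⟨t, ht, hp2⟩ := hp2
      have h1 := hr (u, v) hd _ ⟨s, hs, rfl⟩ _ ⟨t, ht, rfl⟩
      have h2 := fl_far hδ0 hp1 hp2
      have h3 := hδ (u, v)
      linarith
end StrSep

/-- For every `r ∈ (2/3, 1)` there is a constant `c_r > 0` such that every string graph with
`m` edges has an `r`-edge-balanced separator of size at most `c_r·√m`. -/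
theorem stringGraph_edgeBalanced_separator :
    ∀ r : ℝ, 2/3 < r → r < 1 → ∃ c : ℝ, 0 < c ∧
      ∀ (n : ℕ) (G : SimpleGraph (Fin n)), IsStringGraph G →
        ∃ S : Set (Fin n), IsEdgeBalancedSeparator G r S ∧
          (S.ncard : ℝ) ≤ c * Real.sqrt (G.edgeSet.ncard) := by
  classical
  intro r hr _
  refine ⟨36, by norm_num, ?_⟩
  rintro n G ⟨c, hc, hG⟩
  obtain ⟨R, hne, hconn, ⟨K, hK⟩, hadj⟩ := StrSep.discretize G c hc hG
  set m := G.edgeSet.ncard with hm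
  rcases Nat.eq_zero_or_pos m with h0 | h0
  · refine ⟨∅, StrSep.exists_giant G ∅ r hr.le ?_, by simp⟩
    intro g hg
    have h1 : (StrSep.eIn G (StrSep.comp G ∅ g)).ncard ≤ G.edgeSet.ncard :=
      Set.ncard_le_ncard (fun e he => he.1) (Set.toFinite _)
    have h2 := hg.2
    omega
  · by_contra hcon
    refine StrSep.haven_false G R hne hconn K hK hadj (Nat.sqrt m + 1) (Nat.lt_succ_sqrt m) ?_
    intro S hS
    by_contra hg
    refine hcon ⟨S, StrSep.exists_giant G S r hr.le (fun g h => hg ⟨g, h⟩), ?_⟩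
    have h1 : (1:ℝ) ≤ Real.sqrt m := by
      rw [Real.one_le_sqrt]; exact_mod_cast h0
    have h2 : ((Nat.sqrt m : ℕ) : ℝ) ≤ Real.sqrt m := Real.nat_sqrt_le_real_sqrt
    have h3 : (S.ncard : ℝ) ≤ ((18 * (Nat.sqrt m + 1) : ℕ) : ℝ) := by exact_mod_cast hS
    push_cast at h3
    linarith
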